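/- One has sup_{x>0} (3·ln(1 + x/3) − 2·ln(1 + x/2)) / (3·ln(1 + x/3) − ln(1 + x)) = 1/2, i.e., C_ν = 1/2 for ν = −1/2, and the supremum is not attained at any finite x > 0. -/

import Mathlib

open Real in
lemma log_one_add_lt_three_mul_log {x : ℝ} (hx : 0 < x) : log (1 + x) < 3 * log (1 + x/3) := by
  have h : log (1 + x) < log ((1 + x/3) ^ 3) := by
    apply log_lt_log (by positivity)
    nlinarith [pow_pos hx 2, pow_pos hx 3]
  rw [log_pow] at h
  exact_mod_cast h

open Real in
lemma three_mul_log_add_log_lt {x : ℝ} (hx : 0 < x) :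
    3 * log (1 + x/3) + log (1 + x) < 4 * log (1 + x/2) := by
  have h : log ((1 + x/3) ^ 3 * (1 + x)) < log ((1 + x/2) ^ 4) := by
    apply log_lt_log (by positivity)
    nlinarith [pow_pos hx 2, pow_pos hx 3, pow_pos hx 4]
  rw [log_mul (by positivity) (by positivity), log_pow, log_pow] at h
  exact_mod_cast h

open Real in
lemma four_mul_log_le {x : ℝ} (hx : 0 < x) :
    4 * log (1 + x/2) ≤ log 27 + (3 * log (1 + x/3) + log (1 + x)) := by
  have h : log ((1 + x/2) ^ 4) ≤ log (27 * ((1 + x/3) ^ 3 * (1 + x))) := by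
    apply log_le_log (by positivity)
    nlinarith [pow_pos hx 2, pow_pos hx 3, pow_pos hx 4]
  rw [log_mul (by positivity) (by positivity), log_mul (by positivity) (by positivity),
    log_pow, log_pow] at h
  exact_mod_cast h

open Real in
lemma log_le_three_mul_log_sub_log {x : ℝ} (hx : 0 < x) :
    log (x/27) ≤ 3 * log (1 + x/3) - log (1 + x) := by
  have h : log (x/27 * (1 + x)) ≤ log ((1 + x/3) ^ 3) := by
    apply log_le_log (by positivity)
    nlinarith [pow_pos hx 2, pow_pos hx 3]
  rw [log_mul (by positivity) (by positivity), log_pow] at h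
  push_cast at h
  linarith

theorem stmt_16 :
    sSup {y : ℝ | ∃ x : ℝ, 0 < x ∧
        y = (3 * Real.log (1 + x/3) - 2 * Real.log (1 + x/2))
            / (3 * Real.log (1 + x/3) - Real.log (1 + x))} = 1/2
    ∧ ∀ x : ℝ, 0 < x →
        (3 * Real.log (1 + x/3) - 2 * Real.log (1 + x/2))
            / (3 * Real.log (1 + x/3) - Real.log (1 + x)) < 1/2 := by
  have hlt : ∀ x : ℝ, 0 < x →
      (3 * Real.log (1 + x/3) - 2 * Real.log (1 + x/2))
          / (3 * Real.log (1 + x/3) - Real.log (1 + x)) < 1/2 := by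
    intro x hx
    rw [div_lt_iff₀ (by linarith [log_one_add_lt_three_mul_log hx])]
    linarith [three_mul_log_add_log_lt hx]
  refine ⟨csSup_eq_of_forall_le_of_forall_lt_exists_gt ⟨_, 1, one_pos, rfl⟩ ?_ ?_, hlt⟩
  · rintro y ⟨x, hx, rfl⟩
    exact (hlt x hx).le
  · intro w hw
    have hε : 0 < 1/2 - w := by linarith
    have hK : 0 < Real.log 27 := Real.log_pos (by norm_num)
    have hx : 0 < 27 * Real.exp (Real.log 27 / (1/2 - w)) := by positivity
    refine ⟨_, ⟨_, hx, rfl⟩, ?_⟩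
    have hden := log_le_three_mul_log_sub_log hx
    have hnum := four_mul_log_le hx
    rw [mul_div_cancel_left₀ _ (by norm_num), Real.log_exp, div_le_iff₀ hε] at hden
    rw [lt_div_iff₀ (by linarith [log_one_add_lt_three_mul_log hx])]
    linarith
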